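/- Fix an integer d ≥ 1 and set Δ = d + 1, and let β be a real number with (Δ−2)/Δ < β < Δ/(Δ−2). Then there exists ε > 0 such that for every integer k ≥ 1 and every real x, one has k·|1−β²| / (β² + 1 + β(e^x + e^{−x})) < (k/d)(1 − ε). (The left-hand side is the absolute value of the derivative of f^φ_{β,k,s}(x) := s·log β + k·log h_β(e^x).) -/

import Mathlib

/-- The derivative magnitude of `log ∘ h_β ∘ exp` is maximal at the origin. -/
theorem abs_one_sub_sq_div_le {β : ℝ} (hβ : 0 < β) (x : ℝ) :
    |1 - β ^ 2| / (β ^ 2 + 1 + β * (Real.exp x + Real.exp (-x))) ≤ |1 - β| / (1 + β) := by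
  have hcosh : 2 ≤ Real.exp x + Real.exp (-x) := by
    have h := Real.one_le_cosh x
    rw [Real.cosh_eq] at h
    linarith
  have habs : |1 - β ^ 2| = |1 - β| * (1 + β) := by
    rw [show 1 - β ^ 2 = (1 - β) * (1 + β) by ring, abs_mul, abs_of_pos (by linarith : 0 < 1 + β)]
  have hden : (1 + β) * (1 + β) ≤ β ^ 2 + 1 + β * (Real.exp x + Real.exp (-x)) := by
    nlinarith [mul_le_mul_of_nonneg_left hcosh hβ.le]
  rw [habs, div_le_div_iff₀ (by positivity) (by positivity), mul_assoc]
  exact mul_le_mul_of_nonneg_left hden (abs_nonneg _)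

/-- Step-wise correlation decay, with the interval for `β` given in division-free form. -/
theorem exists_stepwise_correlation_decay {d β : ℝ} (hd : 0 < d) (hβ : 0 < β)
    (hlower : d - 1 < β * (d + 1)) (hupper : β * (d - 1) < d + 1) :
    ∃ ε > (0 : ℝ), ∀ k : ℕ, 1 ≤ k → ∀ x : ℝ,
      (k : ℝ) * |1 - β ^ 2| / (β ^ 2 + 1 + β * (Real.exp x + Real.exp (-x)))
        < ((k : ℝ) / d) * (1 - ε) := by
  have hq : d * (|1 - β| / (1 + β)) < 1 := by
    rw [← mul_div_assoc, div_lt_one (by positivity)]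
    rcases abs_cases (1 - β) with ⟨h, _⟩ | ⟨h, _⟩ <;> rw [h] <;> linarith
  refine ⟨(1 - d * (|1 - β| / (1 + β))) / 2, by linarith, fun k hk x => ?_⟩
  have hk' : (0 : ℝ) < k := by exact_mod_cast hk
  rw [mul_div_assoc, div_mul_eq_mul_div, mul_div_assoc]
  refine mul_lt_mul_of_pos_left ((abs_one_sub_sq_div_le hβ x).trans_lt ?_) hk'
  rw [lt_div_iff₀ hd]
  linarith


/-- Step-wise correlation decay: for `β` in the correlation decay
interval, the derivative magnitude of the log tree recurrence is uniformly bounded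
by `(k/d)(1 - ε)`. -/
theorem stepwise_correlation_decay (d : ℕ) (hd : 1 ≤ d) (Δ : ℕ) (hΔ : Δ = d + 1)
    (β : ℝ) (hβ₁ : ((Δ : ℝ) - 2) / (Δ : ℝ) < β) (hβ₂ : β < (Δ : ℝ) / ((Δ : ℝ) - 2)) :
    ∃ ε > (0 : ℝ), ∀ k : ℕ, 1 ≤ k → ∀ x : ℝ,
      (k : ℝ) * |1 - β ^ 2| / (β ^ 2 + 1 + β * (Real.exp x + Real.exp (-x)))
        < ((k : ℝ) / (d : ℝ)) * (1 - ε) := by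
  subst hΔ
  push_cast at hβ₁ hβ₂
  rw [show (d : ℝ) + 1 - 2 = d - 1 by ring] at hβ₁ hβ₂
  have hd' : (1 : ℝ) ≤ d := by exact_mod_cast hd
  have hβ : 0 < β := (div_nonneg (by linarith) (by linarith)).trans_lt hβ₁
  refine exists_stepwise_correlation_decay (by linarith) hβ
    ((div_lt_iff₀ (by linarith)).mp hβ₁) ?_
  rcases hd'.eq_or_lt with h | h
  · rw [← h]
    norm_num
  · exact (lt_div_iff₀ (by linarith)).mp hβ₂
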